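/- Fix a positive integer s and define integers R(n) by the expansion q^s·E_{∞,4}(z)^{−s} = Σ_{n≥0} R(n) q^n, equivalently Π_{m>0 even}(1−q^m)^{−8s} · Π_{m>0 odd}(1−q^m)^{8s} = Σ_{n≥0} R(n) q^n. Then R(0) = 1 and (−1)^n R(n) > 0 for every n ≥ 0; in particular the coefficients R(n) strictly alternate in sign. -/

import Mathlib

open Complex Filter UpperHalfPlane
open scoped MatrixGroups ModularForm Manifold

noncomputable section

/-- `q = e^{2πiz}`. -/
def qexp (z : ℂ) : ℂ := Complex.exp (2 * Real.pi * Complex.I * z)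

/-- `σ^odd(n) = Σ_{d∣n, d odd} d`. -/
def sigmaOdd (n : ℕ) : ℕ := ∑ d ∈ n.divisors.filter (fun d => Odd d), d

/-- `σ₃^alt(n) = Σ_{d∣n} (-1)^d d³`. -/
def sigma3Alt (n : ℕ) : ℤ := ∑ d ∈ n.divisors, (-1 : ℤ) ^ d * (d : ℤ) ^ 3

/-- `σ*_{2,3}(n) = Σ_{d∣n, n/d odd} d³`. -/
def sigmaStar3 (n : ℕ) : ℕ := ∑ d ∈ n.divisors.filter (fun d => Odd (n / d)), d ^ 3

/-- `E_{γ,2} = 1 + 24 Σ σ^odd(n) qⁿ`. -/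
def Egamma2 (z : ℂ) : ℂ := 1 + 24 * ∑' n : ℕ+, (sigmaOdd n : ℂ) * qexp z ^ (n : ℕ)

/-- `E_{0,4} = 1 + 16 Σ σ₃^alt(n) qⁿ`. -/
def E04 (z : ℂ) : ℂ := 1 + 16 * ∑' n : ℕ+, (sigma3Alt n : ℂ) * qexp z ^ (n : ℕ)

/-- `E_{∞,4} = Σ σ*_{2,3}(n) qⁿ`. -/
def Einf4 (z : ℂ) : ℂ := ∑' n : ℕ+, (sigmaStar3 n : ℂ) * qexp z ^ (n : ℕ)

/-- `j₂ = E_{γ,2}² / E_{∞,4}`. -/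
def j2 (z : ℂ) : ℂ := Egamma2 z ^ 2 / Einf4 z

section TaylorNonneg

open scoped ComplexOrder

/-- `f` is holomorphic on the open unit disc and all its Taylor coefficients at `0` are
nonnegative reals. -/
structure TaylorNonneg (f : ℂ → ℂ) : Prop where
  differentiableOn : DifferentiableOn ℂ f (Metric.ball 0 1)
  iteratedDeriv_nonneg : ∀ n, 0 ≤ iteratedDeriv n f 0

lemma TaylorNonneg.analyticAt {f : ℂ → ℂ} (hf : TaylorNonneg f) : AnalyticAt ℂ f 0 :=
  hf.differentiableOn.analyticAt (Metric.ball_mem_nhds 0 one_pos)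

/-- The Taylor coefficients of `f` can be read off from a power series that represents `f` on the
punctured unit disc. -/
lemma iteratedDeriv_eq_of_hasSum_punctured {f : ℂ → ℂ} {c : ℕ → ℂ} (hf : AnalyticAt ℂ f 0)
    (h : ∀ w : ℂ, ‖w‖ < 1 → w ≠ 0 → HasSum (fun n => c n * w ^ n) (f w)) (n : ℕ) :
    iteratedDeriv n f 0 = n.factorial * c n := by
  have hg : HasFPowerSeriesOnBall (fun w => ∑' n, c n * w ^ n)
      (FormalMultilinearSeries.ofScalars ℂ c) 0 1 := by
    refine ⟨?_, one_pos, fun {y} hy => ?_⟩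
    · refine ENNReal.le_of_forall_nnreal_lt fun r hr => ?_
      have hr1 : (r : ℝ) < 1 := by exact_mod_cast hr
      rcases eq_or_ne r 0 with rfl | hr0
      · simp
      · have hs := h (r : ℝ) (by simpa using hr1) (by simpa using hr0)
        refine FormalMultilinearSeries.le_radius_of_tendsto _ (l := 0) ?_
        simpa [FormalMultilinearSeries.ofScalars_norm] using
          hs.summable.tendsto_atTop_zero.norm
    · simp only [FormalMultilinearSeries.ofScalars_apply_eq, smul_eq_mul, zero_add]
      refine Summable.hasSum ?_
      rcases eq_or_ne y 0 with rfl | hy0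
      · exact summable_of_ne_finset_zero (s := {0}) fun b hb => by
          simp [zero_pow (by simpa using hb : b ≠ 0)]
      · refine (h y ?_ hy0).summable
        have hy' : y ∈ Metric.eball (0 : ℂ) (ENNReal.ofReal 1) := by rwa [ENNReal.ofReal_one]
        rw [Metric.eball_ofReal] at hy'
        simpa using hy'
  have hfg : ∀ᶠ w in nhds 0, f w = ∑' n, c n * w ^ n := by
    rw [← hf.frequently_eq_iff_eventually_eq hg.analyticAt]
    refine Filter.Eventually.frequently ?_
    filter_upwards [self_mem_nhdsWithin,
      mem_nhdsWithin_of_mem_nhds (Metric.ball_mem_nhds (0 : ℂ) one_pos)] with w hw hw1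
    exact (h w (by simpa using hw1) hw).tsum_eq.symm
  have hfp := hf.hasFPowerSeriesAt.eq_formalMultilinearSeries
    (hg.hasFPowerSeriesAt.congr (hfg.mono fun _ hw => hw.symm))
  rw [FormalMultilinearSeries.ofScalars_series_eq_iff] at hfp
  have := congrFun hfp n
  have hn : (n.factorial : ℂ) ≠ 0 := by exact_mod_cast n.factorial_ne_zero
  rw [← this, mul_div_cancel₀ _ hn]

lemma TaylorNonneg.one : TaylorNonneg 1 where
  differentiableOn := differentiableOn_const 1
  iteratedDeriv_nonneg n := by
    change 0 ≤ iteratedDeriv n (fun _ : ℂ => (1 : ℂ)) 0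
    rw [iteratedDeriv_const]
    split_ifs <;> simp

lemma TaylorNonneg.iteratedDeriv_mul_apply_zero_le {f g : ℂ → ℂ} (hf : TaylorNonneg f)
    (hg : TaylorNonneg g) (n : ℕ) :
    iteratedDeriv n f 0 * g 0 ≤ iteratedDeriv n (f * g) 0 := by
  rw [iteratedDeriv_mul hf.analyticAt.contDiffAt hg.analyticAt.contDiffAt]
  have hterm : ∀ i ∈ Finset.range (n + 1),
      0 ≤ n.choose i * iteratedDeriv i f 0 * iteratedDeriv (n - i) g 0 := fun i _ =>
    mul_nonneg (mul_nonneg (Nat.cast_nonneg _) (hf.iteratedDeriv_nonneg i))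
      (hg.iteratedDeriv_nonneg _)
  simpa using Finset.single_le_sum hterm (Finset.self_mem_range_succ n)

lemma TaylorNonneg.mul {f g : ℂ → ℂ} (hf : TaylorNonneg f) (hg : TaylorNonneg g) :
    TaylorNonneg (f * g) where
  differentiableOn := hf.differentiableOn.mul hg.differentiableOn
  iteratedDeriv_nonneg n := by
    rw [iteratedDeriv_mul hf.analyticAt.contDiffAt hg.analyticAt.contDiffAt]
    exact Finset.sum_nonneg fun i _ => mul_nonneg
      (mul_nonneg (Nat.cast_nonneg _) (hf.iteratedDeriv_nonneg i)) (hg.iteratedDeriv_nonneg _)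

lemma TaylorNonneg.pow {f : ℂ → ℂ} (hf : TaylorNonneg f) (k : ℕ) : TaylorNonneg (f ^ k) := by
  induction k with
  | zero => simpa using TaylorNonneg.one
  | succ k ih => simpa [pow_succ] using ih.mul hf

lemma TaylorNonneg.prod {ι : Type*} {f : ι → ℂ → ℂ} (hf : ∀ i, TaylorNonneg (f i))
    (s : Finset ι) : TaylorNonneg (∏ i ∈ s, f i) :=
  Finset.prod_induction f TaylorNonneg (fun _ _ => TaylorNonneg.mul) .one fun i _ => hf i

lemma TaylorNonneg.of_tendstoLocallyUniformlyOn {ι : Type*} {l : Filter ι} [l.NeBot]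
    {F : ι → ℂ → ℂ} {f : ℂ → ℂ} (hF : ∀ i, TaylorNonneg (F i))
    (h : TendstoLocallyUniformlyOn F f l (Metric.ball 0 1)) : TaylorNonneg f where
  differentiableOn := h.differentiableOn (.of_forall fun i => (hF i).differentiableOn)
    Metric.isOpen_ball
  iteratedDeriv_nonneg n := by
    have key : ∀ n, (∀ i, DifferentiableOn ℂ (iteratedDeriv n (F i)) (Metric.ball 0 1)) ∧
        TendstoLocallyUniformlyOn (fun i => iteratedDeriv n (F i)) (iteratedDeriv n f) l
          (Metric.ball 0 1) := by
      intro n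
      induction n with
      | zero => simpa using ⟨fun i => (hF i).differentiableOn, h⟩
      | succ n ih =>
        simp only [iteratedDeriv_succ]
        exact ⟨fun i => (ih.1 i).deriv Metric.isOpen_ball,
          ih.2.deriv (.of_forall ih.1) Metric.isOpen_ball⟩
    exact ge_of_tendsto' ((key n).2.tendsto_at (Metric.mem_ball_self one_pos))
      fun i => (hF i).iteratedDeriv_nonneg n

lemma TaylorNonneg.one_add_pow (k : ℕ) : TaylorNonneg fun w => 1 + w ^ k where
  differentiableOn := by fun_prop
  iteratedDeriv_nonneg n := by
    rw [iteratedDeriv_fun_add (by fun_prop) (by fun_prop), iteratedDeriv_const,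
      iteratedDeriv_fun_pow_zero]
    exact add_nonneg (by split_ifs <;> simp) (by split_ifs <;> simp)

lemma one_sub_pow_ne_zero_of_norm_lt_one {w : ℂ} (hw : ‖w‖ < 1) {k : ℕ} (hk : k ≠ 0) :
    1 - w ^ k ≠ 0 := by
  refine sub_ne_zero.2 fun h => ?_
  have := pow_lt_one₀ (norm_nonneg w) hw hk
  rw [← norm_pow, ← h, norm_one] at this
  exact lt_irrefl _ this

lemma differentiableOn_inv_one_sub_pow {k : ℕ} (hk : k ≠ 0) :
    DifferentiableOn ℂ (fun w : ℂ => (1 - w ^ k)⁻¹) (Metric.ball 0 1) :=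
  DifferentiableOn.inv (by fun_prop) fun w hw =>
    one_sub_pow_ne_zero_of_norm_lt_one (by simpa using hw) hk

lemma iteratedDeriv_inv_one_sub_pow {k : ℕ} (hk : k ≠ 0) (n : ℕ) :
    iteratedDeriv n (fun w : ℂ => (1 - w ^ k)⁻¹) 0 = n.factorial * if k ∣ n then 1 else 0 := by
  refine iteratedDeriv_eq_of_hasSum_punctured (c := fun n => if k ∣ n then 1 else 0)
    ((differentiableOn_inv_one_sub_pow hk).analyticAt (Metric.ball_mem_nhds 0 one_pos))
    (fun w hw _ => ?_) n
  have hinj : Function.Injective fun j : ℕ => k * j := mul_right_injective₀ hk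
  rw [← hinj.hasSum_iff]
  · simpa [Function.comp_def, pow_mul] using hasSum_geometric_of_norm_lt_one (ξ := w ^ k)
      (by simpa using pow_lt_one₀ (norm_nonneg w) hw hk)
  · intro m hm
    have : ¬ k ∣ m := fun ⟨j, hj⟩ => hm ⟨j, hj.symm⟩
    simp [this]

lemma TaylorNonneg.inv_one_sub_pow {k : ℕ} (hk : k ≠ 0) :
    TaylorNonneg fun w => (1 - w ^ k)⁻¹ where
  differentiableOn := differentiableOn_inv_one_sub_pow hk
  iteratedDeriv_nonneg n := by
    rw [iteratedDeriv_inv_one_sub_pow hk]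
    split_ifs <;> simp

lemma summable_pow_div_one_sub {r : ℝ} (h0 : 0 ≤ r) (h1 : r < 1) :
    Summable fun i : ℕ => r ^ i / (1 - r) :=
  (summable_geometric_of_lt_one h0 h1).div_const _

lemma TaylorNonneg.tprod {f : ℕ → ℂ → ℂ} (hf : ∀ i, TaylorNonneg (f i))
    (hb : ∀ i w, ‖w‖ < 1 → ‖f i w - 1‖ ≤ ‖w‖ ^ i / (1 - ‖w‖)) :
    TaylorNonneg fun w => ∏' i, f i w := by
  have hcont : ∀ i, ContinuousOn (fun w => f i w - 1) (Metric.ball 0 1) := fun i =>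
    (hf i).differentiableOn.continuousOn.sub continuousOn_const
  have hprod : HasProdLocallyUniformlyOn (fun i w => 1 + (f i w - 1))
      (fun w => ∏' i, (1 + (f i w - 1))) (Metric.ball 0 1) := by
    apply hasProdLocallyUniformlyOn_of_forall_compact Metric.isOpen_ball
    intro K hK hcK
    rcases K.eq_empty_or_nonempty with hN | hN
    · simpa [hasProdUniformlyOn_iff_tendstoUniformlyOn, hN] using tendstoUniformlyOn_empty
    · obtain ⟨q₀, hq₀, _, HB⟩ := hcK.exists_sSup_image_eq_and_ge hN
        (show ContinuousOn (fun q : ℂ ↦ ‖q‖) K by fun_prop)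
      have hq1 : ‖q₀‖ < 1 := by simpa using hK hq₀
      refine (summable_pow_div_one_sub (norm_nonneg _) hq1).hasProdUniformlyOn_nat_one_add
        hcK (.of_forall fun n x hx ↦ ?_) (fun i ↦ (hcont i).mono hK)
      refine (hb n x (by simpa using hK hx)).trans ?_
      have := HB x hx
      have : 0 < 1 - ‖q₀‖ := by linarith
      gcongr
  simp only [add_sub_cancel] at hprod
  refine TaylorNonneg.of_tendstoLocallyUniformlyOn (fun s => TaylorNonneg.prod hf s)
    (hprod.congr fun s w _ => ?_)
  simp

lemma summable_norm_sub_one {a : ℕ → ℂ} {r : ℝ} (h0 : 0 ≤ r) (h1 : r < 1)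
    (hb : ∀ i, ‖a i - 1‖ ≤ r ^ i / (1 - r)) : Summable fun i => ‖a i - 1‖ :=
  .of_nonneg_of_le (fun _ => norm_nonneg _) hb (summable_pow_div_one_sub h0 h1)

lemma multipliable_of_norm_sub_one_le {a : ℕ → ℂ} {r : ℝ} (h0 : 0 ≤ r) (h1 : r < 1)
    (hb : ∀ i, ‖a i - 1‖ ≤ r ^ i / (1 - r)) : Multipliable a := by
  simpa using multipliable_one_add_of_summable (summable_norm_sub_one h0 h1 hb)

lemma tprod_ne_zero_of_norm_sub_one_le {a : ℕ → ℂ} {r : ℝ} (h0 : 0 ≤ r) (h1 : r < 1)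
    (hb : ∀ i, ‖a i - 1‖ ≤ r ^ i / (1 - r)) (ha : ∀ i, a i ≠ 0) : ∏' i, a i ≠ 0 := by
  simpa using tprod_one_add_ne_zero_of_summable (f := fun i => a i - 1) (by simpa using ha)
    (summable_norm_sub_one h0 h1 hb)

lemma norm_inv_one_sub_pow_sub_one_le {w : ℂ} (hw : ‖w‖ < 1) {i k : ℕ} (hk : k ≠ 0)
    (hik : i ≤ k) : ‖(1 - w ^ k)⁻¹ - 1‖ ≤ ‖w‖ ^ i / (1 - ‖w‖) := by
  have hne := one_sub_pow_ne_zero_of_norm_lt_one hw hk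
  have heq : (1 - w ^ k)⁻¹ - 1 = w ^ k / (1 - w ^ k) := by
    field_simp
    ring
  have hle : ‖w‖ ^ k ≤ ‖w‖ := pow_le_of_le_one (norm_nonneg w) hw.le hk
  have hden : 1 - ‖w‖ ≤ ‖1 - w ^ k‖ := by
    have := norm_sub_norm_le 1 (w ^ k)
    rw [norm_one, norm_pow] at this
    linarith
  rw [heq, norm_div, norm_pow]
  have := sub_pos.2 hw
  exact div_le_div₀ (by positivity) (pow_le_pow_of_le_one (norm_nonneg w) hw.le hik) this hden

lemma norm_one_add_pow_sub_one_le {w : ℂ} (hw : ‖w‖ < 1) {i k : ℕ} (hik : i ≤ k) :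
    ‖1 + w ^ k - 1‖ ≤ ‖w‖ ^ i / (1 - ‖w‖) := by
  rw [add_sub_cancel_left, norm_pow]
  refine (pow_le_pow_of_le_one (norm_nonneg w) hw.le hik).trans ?_
  exact le_div_self (by positivity) (sub_pos.2 hw) (by linarith [norm_nonneg w])

/-- The product `∏ (1 - wᵐ)⁻¹` over the even integers `m ≥ 2 (j + 1)`. -/
def evenProd (j : ℕ) (w : ℂ) : ℂ := ∏' i : ℕ, (1 - w ^ (2 * (i + j + 1)))⁻¹

/-- The product `∏ (1 + wᵐ)` over the odd integers `m ≥ 2 j + 1`. -/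
def oddProd (j : ℕ) (w : ℂ) : ℂ := ∏' i : ℕ, (1 + w ^ (2 * (i + j) + 1))

lemma evenProd_apply_zero (j : ℕ) : evenProd j 0 = 1 := by simp [evenProd]

lemma oddProd_apply_zero (j : ℕ) : oddProd j 0 = 1 := by simp [oddProd]

lemma TaylorNonneg.evenProd (j : ℕ) : TaylorNonneg (evenProd j) :=
  .tprod (fun _ => .inv_one_sub_pow (by lia)) fun _ _ hw =>
    norm_inv_one_sub_pow_sub_one_le hw (by lia) (by lia)

lemma TaylorNonneg.oddProd (j : ℕ) : TaylorNonneg (oddProd j) :=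
  .tprod (fun _ => .one_add_pow _) fun _ _ hw => norm_one_add_pow_sub_one_le hw (by lia)

lemma multipliable_evenProd {w : ℂ} (hw : ‖w‖ < 1) (j : ℕ) :
    Multipliable fun i : ℕ => (1 - w ^ (2 * (i + j + 1)))⁻¹ :=
  multipliable_of_norm_sub_one_le (norm_nonneg w) hw fun _ =>
    norm_inv_one_sub_pow_sub_one_le hw (by lia) (by lia)

lemma multipliable_oddProd {w : ℂ} (hw : ‖w‖ < 1) (j : ℕ) :
    Multipliable fun i : ℕ => 1 + w ^ (2 * (i + j) + 1) :=
  multipliable_of_norm_sub_one_le (norm_nonneg w) hw fun _ =>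
    norm_one_add_pow_sub_one_le hw (by lia)

lemma evenProd_ne_zero {w : ℂ} (hw : ‖w‖ < 1) (j : ℕ) : evenProd j w ≠ 0 :=
  tprod_ne_zero_of_norm_sub_one_le (norm_nonneg w) hw
    (fun _ => norm_inv_one_sub_pow_sub_one_le hw (by lia) (by lia))
    fun _ => inv_ne_zero (one_sub_pow_ne_zero_of_norm_lt_one hw (by lia))

lemma oddProd_ne_zero {w : ℂ} (hw : ‖w‖ < 1) (j : ℕ) : oddProd j w ≠ 0 := by
  refine tprod_ne_zero_of_norm_sub_one_le (norm_nonneg w) hw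
    (fun _ => norm_one_add_pow_sub_one_le hw (by lia)) fun i => ?_
  have := one_sub_pow_ne_zero_of_norm_lt_one (w := -w) (by simpa using hw)
    (k := 2 * (i + j) + 1) (by lia)
  rwa [Odd.neg_pow ⟨i + j, rfl⟩, sub_neg_eq_add] at this

lemma evenProd_zero_eq {w : ℂ} (hw : ‖w‖ < 1) :
    evenProd 0 w = (1 - w ^ 2)⁻¹ * evenProd 1 w :=
  tprod_eq_zero_mul' (multipliable_evenProd hw 1)

lemma oddProd_zero_eq {w : ℂ} (hw : ‖w‖ < 1) : oddProd 0 w = (1 + w) * oddProd 1 w := by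
  simpa [oddProd] using tprod_eq_zero_mul' (f := fun i : ℕ => 1 + w ^ (2 * (i + 0) + 1))
    (multipliable_oddProd hw 1)

lemma evenProd_mul_oddProd {w : ℂ} (hw : ‖w‖ < 1) :
    evenProd 0 w * oddProd 0 w = (1 - w ^ 1)⁻¹ * (evenProd 1 w * oddProd 1 w) := by
  have h1 := one_sub_pow_ne_zero_of_norm_lt_one hw one_ne_zero
  have h2 := one_sub_pow_ne_zero_of_norm_lt_one hw two_ne_zero
  have h : (1 - w ^ 2)⁻¹ * (1 + w) = (1 - w ^ 1)⁻¹ := by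
    rw [inv_mul_eq_iff_eq_mul₀ h2, eq_mul_inv_iff_mul_eq₀ h1]
    ring
  rw [evenProd_zero_eq hw, oddProd_zero_eq hw, ← h]
  ring

lemma factorial_le_iteratedDeriv_evenProd_mul_oddProd_pow {k : ℕ} (hk : k ≠ 0) (n : ℕ) :
    (n.factorial : ℂ) ≤ iteratedDeriv n ((evenProd 0 * oddProd 0) ^ k) 0 := by
  obtain ⟨k, rfl⟩ := Nat.exists_eq_succ_of_ne_zero hk
  have hH : TaylorNonneg (evenProd 1 * oddProd 1 * (evenProd 0 * oddProd 0) ^ k) :=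
    ((TaylorNonneg.evenProd 1).mul (.oddProd 1)).mul
      (((TaylorNonneg.evenProd 0).mul (.oddProd 0)).pow k)
  have heq : (evenProd 0 * oddProd 0) ^ (k + 1) =ᶠ[nhds 0] (fun w => (1 - w ^ 1)⁻¹) *
      (evenProd 1 * oddProd 1 * (evenProd 0 * oddProd 0) ^ k) := by
    filter_upwards [Metric.ball_mem_nhds (0 : ℂ) one_pos] with w hw
    simp only [pow_succ, Pi.mul_apply]
    rw [evenProd_mul_oddProd (by simpa using hw)]
    ring
  rw [heq.iteratedDeriv_eq]
  have := (TaylorNonneg.inv_one_sub_pow one_ne_zero).iteratedDeriv_mul_apply_zero_le hH n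
  rw [iteratedDeriv_inv_one_sub_pow one_ne_zero] at this
  simpa [evenProd_apply_zero, oddProd_apply_zero] using this

end TaylorNonneg

lemma exists_qexp_eq {q : ℂ} (hq : ‖q‖ < 1) (hq0 : q ≠ 0) : ∃ z : ℍ, qexp z = q :=
  ⟨⟨_, Function.Periodic.im_invQParam_pos_of_norm_lt_one one_pos hq hq0⟩, by
    simpa [Function.Periodic.qParam, qexp] using
      Function.Periodic.qParam_right_inv one_ne_zero hq0⟩

lemma tprod_eq_evenProd_mul_oddProd_pow {w : ℂ} (hw : ‖w‖ < 1) (k : ℕ) :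
    (∏' m : ℕ+, ((1 - (-w) ^ (2 * (m : ℕ))) ^ k)⁻¹) *
        (∏' m : ℕ+, (1 - (-w) ^ (2 * (m : ℕ) - 1)) ^ k) =
      ((evenProd 0 * oddProd 0) ^ k) w := by
  rw [tprod_pnat_eq_tprod_succ (f := fun m : ℕ => ((1 - (-w) ^ (2 * m)) ^ k)⁻¹),
    tprod_pnat_eq_tprod_succ (f := fun m : ℕ => (1 - (-w) ^ (2 * m - 1)) ^ k)]
  have hodd : ∀ i : ℕ, 1 - (-w) ^ (2 * (i + 1) - 1) = 1 + w ^ (2 * (i + 0) + 1) := fun i => by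
    rw [show 2 * (i + 1) - 1 = 2 * (i + 0) + 1 by lia, Odd.neg_pow ⟨i + 0, rfl⟩, sub_neg_eq_add]
  have heven : ∀ i : ℕ, (-w) ^ (2 * (i + 1)) = w ^ (2 * (i + 0 + 1)) := fun i => by
    rw [Even.neg_pow (even_two_mul _), add_zero]
  simp only [hodd, heven, ← inv_pow]
  rw [(multipliable_evenProd hw 0).tprod_pow, (multipliable_oddProd hw 0).tprod_pow, ← mul_pow]
  rfl

/-- Alternation of sign of the coefficients `R(n)` of
`qˢ·E_{∞,4}⁻ˢ = Π_{m even}(1−qᵐ)^{−8s} · Π_{m odd}(1−qᵐ)^{8s} = Σ R(n) qⁿ`: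
`R(0) = 1` and `(−1)ⁿ R(n) > 0` for all `n`. -/
theorem stmt15 (s : ℕ) (hs : 0 < s) (R : ℕ → ℤ)
    (hexp : ∀ z : ℍ,
      (∏' m : ℕ+, ((1 - qexp (z : ℂ) ^ (2 * (m : ℕ))) ^ (8 * s))⁻¹) *
          (∏' m : ℕ+, (1 - qexp (z : ℂ) ^ (2 * (m : ℕ) - 1)) ^ (8 * s)) =
        ∑' n : ℕ, (R n : ℂ) * qexp (z : ℂ) ^ n) :
    R 0 = 1 ∧ ∀ n : ℕ, 0 < (-1 : ℤ) ^ n * R n := by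
  have hk : 8 * s ≠ 0 := by lia
  have hF : AnalyticAt ℂ ((evenProd 0 * oddProd 0) ^ (8 * s)) 0 :=
    (((TaylorNonneg.evenProd 0).mul (.oddProd 0)).pow _).analyticAt
  have hcoeff : ∀ n : ℕ, iteratedDeriv n ((evenProd 0 * oddProd 0) ^ (8 * s)) 0 =
      n.factorial * ((-1) ^ n * R n : ℂ) := by
    refine iteratedDeriv_eq_of_hasSum_punctured (c := fun n => (-1) ^ n * R n) hF
      fun w hw hw0 => ?_
    obtain ⟨z, hz⟩ := exists_qexp_eq (q := -w) (by simpa using hw) (neg_ne_zero.2 hw0)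
    have h := hexp z
    rw [hz, tprod_eq_evenProd_mul_oddProd_pow hw] at h
    have hne : ((evenProd 0 * oddProd 0) ^ (8 * s)) w ≠ 0 :=
      pow_ne_zero _ (mul_ne_zero (evenProd_ne_zero hw 0) (oddProd_ne_zero hw 0))
    have hsum : Summable fun n : ℕ => (R n : ℂ) * (-w) ^ n := by
      by_contra hns
      exact hne (h.trans (tsum_eq_zero_of_not_summable hns))
    rw [h]
    refine hsum.hasSum.congr_fun ?_
    intro n
    rw [neg_pow]
    ring
  refine ⟨?_, fun n => ?_⟩
  · have h := hcoeff 0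
    simp only [iteratedDeriv_zero, Pi.pow_apply, Pi.mul_apply, evenProd_apply_zero,
      oddProd_apply_zero] at h
    simpa using h.symm
  · have h := factorial_le_iteratedDeriv_evenProd_mul_oddProd_pow hk n
    rw [hcoeff] at h
    have h' : ((n.factorial : ℤ) : ℝ) ≤ ((n.factorial * ((-1) ^ n * R n) : ℤ) : ℝ) := by
      rw [← Complex.real_le_real]
      push_cast
      exact h
    have hn : (0 : ℤ) < n.factorial := by exact_mod_cast n.factorial_pos
    exact pos_of_mul_pos_right (hn.trans_le (by exact_mod_cast h')) hn.le

end
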